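/- Let a=1/2 and d=3/2 (the case κ=4). The function H(r,θ) = ((1-r²)/(1+r²-2r cos θ))^{1/2}, defined for 0<r<1 and θ∈ℝ with (r,θ)≠(1,0) mod 2π, satisfies the PDE H_{θθ} + aF H_θ + aJ H_r + (a-1/4) F_θ H = 0, where F(r,θ) = 2r sin θ/(1+r²-2r cos θ) and J(r,θ) = r(1-r²)/(1+r²-2r cos θ). -/

import Mathlib

open Real

noncomputable def H0 (r θ : ℝ) : ℝ := ((1 - r^2) / (1 + r^2 - 2*r*Real.cos θ)) ^ ((1:ℝ)/2)

noncomputable def F0 (r θ : ℝ) : ℝ := 2*r*Real.sin θ / (1 + r^2 - 2*r*Real.cos θ)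

noncomputable def J0 (r θ : ℝ) : ℝ := r*(1 - r^2) / (1 + r^2 - 2*r*Real.cos θ)

theorem poisson_denom_pos {r : ℝ} (hr0 : 0 < r) (hr1 : r < 1) (θ : ℝ) :
    0 < 1 + r^2 - 2*r*Real.cos θ := by
  nlinarith [Real.cos_le_one θ, sq_pos_of_pos (sub_pos.mpr hr1)]

theorem hasDerivAt_poisson_denom_angle (r θ : ℝ) :
    HasDerivAt (fun t => 1 + r^2 - 2*r*Real.cos t) (2*r*Real.sin θ) θ := by
  refine HasDerivAt.congr_deriv (((Real.hasDerivAt_cos θ).const_mul (2*r)).const_sub (1 + r^2)) ?_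
  ring

theorem hasDerivAt_F0_angle {r : ℝ} (hr0 : 0 < r) (hr1 : r < 1) (θ : ℝ) :
    HasDerivAt (fun t => F0 r t)
      (2*r*((1 + r^2)*Real.cos θ - 2*r) / (1 + r^2 - 2*r*Real.cos θ)^2) θ := by
  unfold F0
  refine HasDerivAt.congr_deriv (((Real.hasDerivAt_sin θ).const_mul (2*r)).fun_div
    (hasDerivAt_poisson_denom_angle r θ) (poisson_denom_pos hr0 hr1 θ).ne') ?_
  congr 1
  linear_combination -4*r^2 * Real.sin_sq_add_cos_sq θ

/-- Logarithmic differentiation of a square root. -/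
theorem HasDerivAt.rpow_half {f : ℝ → ℝ} {f' x : ℝ} (hf : HasDerivAt f f' x) (hx : 0 < f x) :
    HasDerivAt (fun t => f t ^ ((1:ℝ)/2)) (f' / (2 * f x) * f x ^ ((1:ℝ)/2)) x := by
  refine HasDerivAt.congr_deriv (hf.rpow_const (p := (1:ℝ)/2) (Or.inl hx.ne')) ?_
  rw [Real.rpow_sub_one hx.ne']
  field_simp

theorem hasDerivAt_H0_angle {r : ℝ} (hr0 : 0 < r) (hr1 : r < 1) (θ : ℝ) :
    HasDerivAt (fun t => H0 r t) (-(1/2) * F0 r θ * H0 r θ) θ := by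
  have hD := poisson_denom_pos hr0 hr1 θ
  have hN : 0 < 1 - r^2 := by nlinarith
  unfold H0 F0
  refine HasDerivAt.congr_deriv (((hasDerivAt_const θ (1 - r^2)).fun_div
    (hasDerivAt_poisson_denom_angle r θ) hD.ne').rpow_half (div_pos hN hD)) ?_
  congr 1
  field_simp
  ring

theorem hasDerivAt_H0_radius {r : ℝ} (hr0 : 0 < r) (hr1 : r < 1) (θ : ℝ) :
    HasDerivAt (fun s => H0 s θ)
      (((1 + r^2)*Real.cos θ - 2*r) / ((1 - r^2) * (1 + r^2 - 2*r*Real.cos θ)) * H0 r θ) r := by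
  have hD := poisson_denom_pos hr0 hr1 θ
  have hN : 0 < 1 - r^2 := by nlinarith
  have hN' : HasDerivAt (fun s : ℝ => 1 - s^2) (-(2*r)) r := by
    simpa using (hasDerivAt_pow 2 r).const_sub 1
  have hD' : HasDerivAt (fun s : ℝ => 1 + s^2 - 2*s*Real.cos θ) (2*r - 2*Real.cos θ) r := by
    simpa using ((hasDerivAt_pow 2 r).const_add 1).fun_sub
      (((hasDerivAt_id' r).const_mul 2).mul_const (Real.cos θ))
  unfold H0
  refine HasDerivAt.congr_deriv ((hN'.fun_div hD' hD.ne').rpow_half (div_pos hN hD)) ?_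
  congr 1
  field_simp
  ring

/-- with a = 1/2 (κ = 4), H(r,θ) = ((1-r²)/(1+r²-2r cos θ))^{1/2}
satisfies H_{θθ} + a F H_θ + a J H_r + (a - 1/4) F_θ H = 0 for 0 < r < 1. -/
theorem stmt_0 (a : ℝ) (ha : a = 1/2) (r θ : ℝ) (hr0 : 0 < r) (hr1 : r < 1) :
    deriv (fun θ' => deriv (fun θ'' => H0 r θ'') θ') θ
      + a * F0 r θ * deriv (fun θ' => H0 r θ') θ
      + a * J0 r θ * deriv (fun r' => H0 r' θ) r
      + (a - 1/4) * deriv (fun θ' => F0 r θ') θ * H0 r θ = 0 := by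
  have hD := poisson_denom_pos hr0 hr1 θ
  have hN : 0 < 1 - r^2 := by nlinarith
  have hF := hasDerivAt_F0_angle hr0 hr1 θ
  have hH := hasDerivAt_H0_angle hr0 hr1
  have h2 := ((hF.const_mul (-(1/2))).fun_mul (hH θ)).deriv
  simp only [fun t => (hH t).deriv]
  rw [h2, hF.deriv, (hasDerivAt_H0_radius hr0 hr1 θ).deriv, ha]
  unfold J0
  field_simp
  ring
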